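/- For every n ∈ ℤ, the distribution of Y_n under μ is the Gaussian measure N(0,k) on ℝ (mean 0, variance k). -/

import Mathlib

open Real MeasureTheory ProbabilityTheory

/-- The density `ψ` of the measure `ν` on `ℝ^k`. -/
noncomputable def psi (k : ℕ) (x : Fin k → ℝ) : ℝ :=
  (2 * Real.pi) ^ (-(k : ℝ) / 2) *
    (1 + (∏ i, x i) * Real.exp (-(∑ i, x i ^ 2) / 2)) *
    Real.exp (-(∑ i, x i ^ 2) / 2)

/-- The measure `ν` on `ℝ^k` with density `ψ` with respect to Lebesgue measure. -/
noncomputable def nu (k : ℕ) : Measure (Fin k → ℝ) :=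
  (volume : Measure (Fin k → ℝ)).withDensity fun x => ENNReal.ofReal (psi k x)

/-- `μ` is the joint law of an i.i.d. bilateral sequence `(X_{n,1},…,X_{n,k})`,
`n ∈ ℤ`, with common distribution `ν`: every finite-dimensional marginal of `μ`
is the corresponding finite product of copies of `ν`. -/
def IsIIDSeq (k : ℕ) (μ : Measure (ℤ → Fin k → ℝ)) : Prop :=
  ∀ I : Finset ℤ, μ.map I.restrict = Measure.pi fun _ : I => nu k

/-- `Y n = X_{n,k} + X_{n+1,k-1} + ⋯ + X_{n+k-1,1}` (coordinates indexed by
`Fin k`, so coordinate `i ∈ {1,…,k}` corresponds to index `i-1 : Fin k`). -/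
noncomputable def Y (k : ℕ) (n : ℤ) (ω : ℤ → Fin k → ℝ) : ℝ :=
  ∑ j : Fin k, ω (n + ((j : ℕ) : ℤ)) j.rev

theorem abs_mul_exp_neg_sq_div_two_le_one (t : ℝ) : |t * Real.exp (-t ^ 2 / 2)| ≤ 1 := by
  rw [abs_mul, abs_of_pos (Real.exp_pos _), neg_div, Real.exp_neg, ← div_eq_mul_inv,
    div_le_one (Real.exp_pos _)]
  have h := Real.add_one_le_exp (t ^ 2 / 2)
  nlinarith [sq_nonneg (|t| - 1), sq_abs t]

theorem psi_eq_mul_prod_gaussianPDFReal (k : ℕ) (x : Fin k → ℝ) :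
    psi k x = (1 + ∏ i, x i * Real.exp (-x i ^ 2 / 2)) * ∏ i, gaussianPDFReal 0 1 (x i) := by
  have hexp : Real.exp (-(∑ i, x i ^ 2) / 2) = ∏ i, Real.exp (-x i ^ 2 / 2) := by
    rw [← Real.exp_sum, ← Finset.sum_neg_distrib, Finset.sum_div]
  have hconst : (2 * Real.pi) ^ (-(k : ℝ) / 2) = (√(2 * Real.pi))⁻¹ ^ k := by
    rw [Real.sqrt_eq_rpow, ← Real.rpow_neg (by positivity), ← Real.rpow_natCast,
      ← Real.rpow_mul (by positivity)]
    ring_nf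
  have hprod : ∏ i, gaussianPDFReal 0 1 (x i) =
      (√(2 * Real.pi))⁻¹ ^ k * ∏ i, Real.exp (-x i ^ 2 / 2) := by
    simp [gaussianPDFReal, Finset.prod_mul_distrib]
  rw [psi, hexp, hconst, hprod, Finset.prod_mul_distrib]
  ring

theorem psi_nonneg (k : ℕ) (x : Fin k → ℝ) : 0 ≤ psi k x := by
  rw [psi_eq_mul_prod_gaussianPDFReal]
  refine mul_nonneg ?_ (Finset.prod_nonneg fun i _ => gaussianPDFReal_nonneg _ _ _)
  have h : |∏ i, x i * Real.exp (-x i ^ 2 / 2)| ≤ 1 := by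
    rw [Finset.abs_prod]
    exact Finset.prod_le_one (fun _ _ => abs_nonneg _)
      fun i _ => abs_mul_exp_neg_sq_div_two_le_one (x i)
  linarith [(abs_le.mp h).1]

theorem measurable_psi (k : ℕ) : Measurable (psi k) := by
  unfold psi
  fun_prop

/-- The reflection of `ℝ^k` that changes the sign of the `j`-th coordinate. -/
def coordReflection {k : ℕ} (j : Fin k) (x : Fin k → ℝ) : Fin k → ℝ :=
  fun l => (if l = j then Neg.neg else id : ℝ → ℝ) (x l)

theorem volume_preserving_coordReflection {k : ℕ} (j : Fin k) :
    MeasurePreserving (coordReflection j) volume volume := by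
  refine volume_preserving_pi fun l => ?_
  split_ifs
  · exact Measure.measurePreserving_neg volume
  · exact MeasurePreserving.id volume

theorem psi_add_psi_coordReflection {k : ℕ} (j : Fin k) (x : Fin k → ℝ) :
    psi k x + psi k (coordReflection j x) = 2 * ∏ i, gaussianPDFReal 0 1 (x i) := by
  have hsq (l : Fin k) : coordReflection j x l ^ 2 = x l ^ 2 := by
    unfold coordReflection
    split_ifs <;> simp
  have hprod : ∏ l, coordReflection j x l = -∏ l, x l := by
    rw [← Finset.mul_prod_erase _ _ (Finset.mem_univ j),
      ← Finset.mul_prod_erase _ (fun l => x l) (Finset.mem_univ j), ← neg_mul]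
    congr 1
    · simp [coordReflection]
    · exact Finset.prod_congr rfl fun l hl => by
        simp [coordReflection, Finset.ne_of_mem_erase hl]
  have hpdf (l : Fin k) :
      gaussianPDFReal 0 1 (coordReflection j x l) = gaussianPDFReal 0 1 (x l) := by
    simp [gaussianPDFReal, hsq]
  simp only [psi_eq_mul_prod_gaussianPDFReal, hpdf, hsq, Finset.prod_mul_distrib, hprod]
  ring

theorem pi_withDensity_ofReal {ι : Type*} [Fintype ι] {f : ℝ → ℝ} (hf : Integrable f)
    (hf0 : ∀ t, 0 ≤ f t) :
    (volume : Measure (ι → ℝ)).withDensity (fun x => ENNReal.ofReal (∏ i, f (x i))) =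
      Measure.pi fun _ => (volume : Measure ℝ).withDensity fun t => ENNReal.ofReal (f t) := by
  have : IsFiniteMeasure ((volume : Measure ℝ).withDensity fun t => ENNReal.ofReal (f t)) :=
    isFiniteMeasure_withDensity_ofReal hf.2
  refine (Measure.pi_eq fun s hs => ?_).symm
  rw [withDensity_apply _ (MeasurableSet.univ_pi hs), volume_pi, Measure.restrict_pi_pi,
    ← ofReal_integral_eq_lintegral_ofReal
      (Integrable.fintype_prod fun i => hf.integrableOn)
      (.of_forall fun x => Finset.prod_nonneg fun i _ => hf0 _),
    integral_fintype_prod_eq_prod (fun _ => f),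
    ENNReal.ofReal_prod_of_nonneg fun i _ => integral_nonneg hf0]
  refine Finset.prod_congr rfl fun i _ => ?_
  rw [withDensity_apply _ (hs i),
    ofReal_integral_eq_lintegral_ofReal hf.integrableOn (.of_forall hf0)]

theorem map_eval_nu {k : ℕ} (hk : 1 < k) (i : Fin k) :
    (nu k).map (fun x => x i) = gaussianReal 0 1 := by
  have : Nontrivial (Fin k) := Fin.nontrivial_iff_two_le.mpr hk
  obtain ⟨j, hj⟩ := exists_ne i
  have hpi : (volume : Measure (Fin k → ℝ)).withDensity
      (fun x => ENNReal.ofReal (∏ l, gaussianPDFReal 0 1 (x l))) =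
      Measure.pi fun _ => gaussianReal 0 1 := by
    rw [pi_withDensity_ofReal (integrable_gaussianPDFReal 0 1) (gaussianPDFReal_nonneg 0 1),
      gaussianReal_of_var_ne_zero 0 one_ne_zero]
    rfl
  rw [← (measurePreserving_eval (fun _ : Fin k => gaussianReal 0 1) i).map_eq, ← hpi]
  ext s hs
  have hA : MeasurableSet ((fun x : Fin k → ℝ => x i) ⁻¹' s) := measurable_pi_apply i hs
  rw [Measure.map_apply (measurable_pi_apply i) hs, Measure.map_apply (measurable_pi_apply i) hs,
    nu, withDensity_apply _ hA]
  change _ = (volume.withDensity _) ((fun x : Fin k → ℝ => x i) ⁻¹' s)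
  rw [withDensity_apply _ hA]
  have hpre : coordReflection j ⁻¹' ((fun x : Fin k → ℝ => x i) ⁻¹' s) =
      (fun x : Fin k → ℝ => x i) ⁻¹' s := by
    ext x
    simp [coordReflection, hj.symm]
  have hrefl := (volume_preserving_coordReflection j).setLIntegral_comp_preimage hA
    (measurable_psi k).ennreal_ofReal
  rw [hpre] at hrefl
  refine (ENNReal.mul_right_inj two_ne_zero ENNReal.ofNat_ne_top).mp ?_
  rw [two_mul]
  nth_rw 2 [← hrefl]
  rw [← lintegral_add_left (measurable_psi k).ennreal_ofReal,
    ← lintegral_const_mul' _ _ ENNReal.ofNat_ne_top]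
  refine lintegral_congr fun x => ?_
  rw [← ENNReal.ofReal_add (psi_nonneg k _) (psi_nonneg k _), psi_add_psi_coordReflection,
    ENNReal.ofReal_mul zero_le_two, ENNReal.ofReal_ofNat]

theorem isProbabilityMeasure_nu {k : ℕ} (hk : 1 < k) : IsProbabilityMeasure (nu k) := by
  have h := map_eval_nu hk ⟨0, by omega⟩
  refine ⟨?_⟩
  rw [← measure_univ (μ := gaussianReal 0 1), ← h,
    Measure.map_apply (measurable_pi_apply _) .univ, Set.preimage_univ]

theorem IsIIDSeq.map_eval {k : ℕ} [IsProbabilityMeasure (nu k)] {μ : Measure (ℤ → Fin k → ℝ)}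
    (hμ : IsIIDSeq k μ) (m : ℤ) : μ.map (fun ω => ω m) = nu k := by
  have h := (measurePreserving_eval (fun _ : ({m} : Finset ℤ) => nu k) ⟨m, by simp⟩).map_eq
  rw [← hμ {m}, Measure.map_map (by fun_prop) (by fun_prop)] at h
  exact h

theorem IsIIDSeq.iIndepFun_restrict {k : ℕ} [IsProbabilityMeasure (nu k)]
    {μ : Measure (ℤ → Fin k → ℝ)} [IsProbabilityMeasure μ] (hμ : IsIIDSeq k μ) (I : Finset ℤ) :
    iIndepFun (fun (m : I) (ω : ℤ → Fin k → ℝ) => ω m) μ := by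
  rw [iIndepFun_iff_map_fun_eq_pi_map fun m => (measurable_pi_apply _).aemeasurable]
  simp only [hμ.map_eval]
  exact hμ I

theorem map_sum_eq_gaussianReal_of_iIndepFun {Ω ι : Type*} [MeasurableSpace Ω] [Fintype ι]
    {P : Measure Ω} [IsProbabilityMeasure P] {X : ι → Ω → ℝ} {v : NNReal}
    (hX : ∀ i, Measurable (X i)) (hlaw : ∀ i, P.map (X i) = gaussianReal 0 v)
    (hindep : iIndepFun X P) :
    P.map (fun ω => ∑ i, X i ω) = gaussianReal 0 (Fintype.card ι * v) := by
  have : IsProbabilityMeasure (P.map fun ω => ∑ i, X i ω) :=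
    Measure.isProbabilityMeasure_map (by fun_prop)
  refine Measure.ext_of_charFun ?_
  rw [hindep.charFun_map_fun_sum_eq_prod fun i => (hX i).aemeasurable]
  ext t
  simp only [Finset.prod_apply, hlaw, charFun_gaussianReal, Finset.prod_const, ← Complex.exp_nat_mul]
  congr 1
  push_cast [Finset.card_univ]
  ring

/-- Each `Y n` has distribution `N(0, k)`. -/
theorem map_Y_eq_gaussian (k : ℕ) (hk : 1 < k)
    (μ : Measure (ℤ → Fin k → ℝ)) [IsProbabilityMeasure μ]
    (hμ : IsIIDSeq k μ) (n : ℤ) :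
    μ.map (Y k n) = gaussianReal 0 (k : NNReal) := by
  have := isProbabilityMeasure_nu hk
  let g (j : Fin k) : Finset.univ.image fun j : Fin k => n + ((j : ℕ) : ℤ) :=
    ⟨n + ((j : ℕ) : ℤ), Finset.mem_image_of_mem _ (Finset.mem_univ j)⟩
  have hg : Function.Injective g := fun a b hab => by
    simpa [g, Fin.ext_iff] using hab
  have hindep : iIndepFun (fun (j : Fin k) (ω : ℤ → Fin k → ℝ) => ω (n + ((j : ℕ) : ℤ)) j.rev) μ :=
    ((hμ.iIndepFun_restrict _).precomp hg).comp (fun j x => x j.rev)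
      fun j => measurable_pi_apply _
  have hlaw (j : Fin k) : μ.map (fun ω => ω (n + ((j : ℕ) : ℤ)) j.rev) = gaussianReal 0 1 := by
    rw [← map_eval_nu hk j.rev, ← hμ.map_eval (n + ((j : ℕ) : ℤ)),
      Measure.map_map (measurable_pi_apply _) (measurable_pi_apply _)]
    rfl
  change μ.map (fun ω => ∑ j : Fin k, ω (n + ((j : ℕ) : ℤ)) j.rev) = _
  simpa using map_sum_eq_gaussianReal_of_iIndepFun (fun j => by fun_prop) hlaw hindep
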